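/- Suppose κ₁, κ₂ ≤ λ are regular cardinals with 2^{ℵ₀} < 2^{κ₁} < κ₂, and θ is a cardinal with ℵ₀ < θ = cf(θ) ≤ 2^{ℵ₀}. Then there is a λ-regular ultrafilter D on λ such that lcf(ℵ₀, D) = θ and every (κ₁, κ₂)-pre-cut mod D is realized (i.e. the linear order ℕ^λ/D has no (κ₁, κ₂)-cuts). -/

import Mathlib

open Cardinal Set

universe u

/-- `A = ∅ mod D`: the complement of `A` belongs to the filter `D`. -/
def ZeroMod {I : Type u} (D : Filter I) (A : Set I) : Prop := Aᶜ ∈ D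

/-- `A ≠ ∅ mod D`: the complement of `A` does not belong to the filter `D`. -/
def NonzeroMod {I : Type u} (D : Filter I) (A : Set I) : Prop := Aᶜ ∉ D

/-- `A ⊆ B mod D`. -/
def SubsetMod {I : Type u} (D : Filter I) (A B : Set I) : Prop := ZeroMod D (A \ B)

/-- `A = B mod D`. -/
def EqMod {I : Type u} (D : Filter I) (A B : Set I) : Prop := SubsetMod D A B ∧ SubsetMod D B A

/-- `D` is a `lam`-regular filter on `I`: there is a family `⟨X i : i < lam⟩` of members of `D`
such that every `t ∈ I` belongs to only finitely many of the `X i`. -/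
def IsRegularFilter {I : Type u} (lam : Cardinal.{u}) (D : Filter I) : Prop :=
  ∃ X : Ordinal.{u} → Set I, (∀ i, i < lam.ord → X i ∈ D) ∧
    ∀ t : I, {i : Ordinal.{u} | i < lam.ord ∧ t ∈ X i}.Finite

/-- `f : I → ℕ` is `D`-nonstandard. -/
def IsNonstandard {I : Type u} (D : Filter I) (f : I → ℕ) : Prop := ∀ n : ℕ, {t | n < f t} ∈ D

/-- `f <_D g`. -/
def ltD {I : Type u} (D : Filter I) (f g : I → ℕ) : Prop := {t | f t < g t} ∈ D

/-- `f ≤_D g`. -/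
def leD {I : Type u} (D : Filter I) (f g : I → ℕ) : Prop := {t | f t ≤ g t} ∈ D

/-- Flexibility for a family of sets (e.g. `D.sets`): for every nonstandard `f` there is a
`theta`-indexed family of members below `f`. -/
def IsFlexibleSets {I : Type u} (theta : Cardinal.{u}) (F : Set (Set I)) : Prop :=
  ∀ f : I → ℕ, (∀ n : ℕ, {t | n < f t} ∈ F) →
    ∃ X : Ordinal.{u} → Set I, (∀ α, α < theta.ord → X α ∈ F) ∧
      ∀ t : I, #{α : Ordinal.{u} // α < theta.ord ∧ t ∈ X α} ≤ (f t : Cardinal)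

/-- `D` is a `theta`-flexible filter. -/
def IsFlexible {I : Type u} (theta : Cardinal.{u}) (D : Filter I) : Prop :=
  IsFlexibleSets theta D.sets

/-- `F` (e.g. the sets of a filter) is `mu⁺`-good: every monotonic map from finite subsets of `mu`
into `F` has a multiplicative refinement. Finite subsets of `mu` are represented as finite sets of
ordinals `< mu.ord`. -/
def IsGoodSets {I : Type u} (mu : Cardinal.{u}) (F : Set (Set I)) : Prop :=
  ∀ f : Finset Ordinal.{u} → Set I,
    (∀ u : Finset Ordinal.{u}, ↑u ⊆ Set.Iio mu.ord → f u ∈ F) →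
    (∀ u v : Finset Ordinal.{u}, ↑v ⊆ Set.Iio mu.ord → u ⊆ v → f v ⊆ f u) →
    ∃ f' : Finset Ordinal.{u} → Set I,
      (∀ u, ↑u ⊆ Set.Iio mu.ord → f' u ∈ F) ∧
      (∀ u, ↑u ⊆ Set.Iio mu.ord → f' u ⊆ f u) ∧
      ∀ u v, ↑u ⊆ Set.Iio mu.ord → ↑v ⊆ Set.Iio mu.ord → f' u ∩ f' v = f' (u ∪ v)

/-- The filter `D` is `mu⁺`-good. -/
def IsGoodFilter {I : Type u} (mu : Cardinal.{u}) (D : Filter I) : Prop := IsGoodSets mu D.sets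

/-- An element of `FIN(G)`: a function whose domain is a finite subset of `G`, with
`h(g) ∈ range(g)` for each `g` in the domain. Functions in `G` take ordinal values. -/
structure PartialAssignment (I : Type u) (G : Set (I → Ordinal.{u})) where
  dom : Finset (I → Ordinal.{u})
  dom_sub : ↑dom ⊆ G
  val : (I → Ordinal.{u}) → Ordinal.{u}
  val_mem : ∀ g ∈ dom, val g ∈ Set.range g

/-- The set `A_h = {t ∈ I : g(t) = h(g) for all g ∈ dom h}`. -/
def PartialAssignment.Aset {I : Type u} {G : Set (I → Ordinal.{u})}
    (h : PartialAssignment I G) : Set I :=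
  {t | ∀ g ∈ h.dom, g t = h.val g}

/-- `G` is independent mod `D`: `A_h ≠ ∅ mod D` for every `h ∈ FIN(G)`. -/
def IndependentMod {I : Type u} (D : Filter I) (G : Set (I → Ordinal.{u})) : Prop :=
  ∀ h : PartialAssignment I G, NonzeroMod D h.Aset

/-- `(I, D, G)` is a `(lam, mu)`-pre-good triple: `|I| = lam`, `D` is a `lam`-regular filter,
`G` is a family of functions from `I` to `mu` (ordinals `< mu.ord`), independent mod `D`. -/
def IsPreGoodTriple {I : Type u} (lam mu : Cardinal.{u}) (D : Filter I)
    (G : Set (I → Ordinal.{u})) : Prop :=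
  #I = lam ∧ IsRegularFilter lam D ∧ (∀ g ∈ G, ∀ t : I, g t < mu.ord) ∧ IndependentMod D G

/-- `(I, D, G)` is a `(lam, mu)`-good triple: pre-good and `D` maximal among filters modulo which
`G` is independent. -/
def IsGoodTriple {I : Type u} (lam mu : Cardinal.{u}) (D : Filter I)
    (G : Set (I → Ordinal.{u})) : Prop :=
  IsPreGoodTriple lam mu D G ∧
    ∀ D' : Filter I, (∀ A ∈ D, A ∈ D') → IndependentMod D' G → D' = D

/-- `A` is supported by `G` mod `D`: there is a partition of `I` into sets of the form `A_h`,
`h ∈ FIN(G)`, each of which is `⊆ A mod D` or disjoint from `A mod D`. -/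
def SupportedBy {I : Type u} (D : Filter I) (G : Set (I → Ordinal.{u})) (A : Set I) : Prop :=
  ∃ P : Set (Set I),
    (∀ X ∈ P, ∃ h : PartialAssignment I G, X = h.Aset) ∧
    (∀ X ∈ P, ∀ Y ∈ P, X ≠ Y → X ∩ Y = ∅) ∧
    ⋃₀ P = Set.univ ∧
    ∀ X ∈ P, SubsetMod D X A ∨ ZeroMod D (X ∩ A)

/-- `R` is the edge relation of a model of the random graph with vertex set `mu`
(identified with the ordinals `< mu.ord`). -/
def IsRandomGraphOn (mu : Cardinal.{u}) (R : Ordinal.{u} → Ordinal.{u} → Prop) : Prop :=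
  (∀ a b, a < mu.ord → b < mu.ord → (R a b ↔ R b a)) ∧
  (∀ a, a < mu.ord → ¬ R a a) ∧
  ∀ U V : Finset Ordinal.{u}, ↑U ⊆ Set.Iio mu.ord → ↑V ⊆ Set.Iio mu.ord → Disjoint U V →
    ∃ x, x < mu.ord ∧ (∀ a ∈ U, R x a) ∧ ∀ b ∈ V, ¬ R x b

/-- An ordinal `γ = β + n` (`β` limit or zero, `n < ω`) is even iff `n` is even,
equivalently iff `γ = 2·δ` for some ordinal `δ`. -/
def EvenOrdinal (γ : Ordinal.{u}) : Prop := ∃ δ : Ordinal.{u}, γ = 2 * δ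

/-- `lcf(ℵ₀, D)`: the least cardinality of a family `S` of `D`-nonstandard functions
such that every `D`-nonstandard `g` satisfies `f ≤_D g` for some `f ∈ S`. -/
noncomputable def lcfAleph0 {I : Type u} (D : Filter I) : Cardinal.{u} :=
  sInf { c : Cardinal.{u} | ∃ S : Set (I → ℕ), #S = c ∧ (∀ f ∈ S, IsNonstandard D f) ∧
    ∀ g : I → ℕ, IsNonstandard D g → ∃ f ∈ S, leD D f g }

/-- A filter on a Boolean algebra. -/
def IsBAFilter {B : Type u} [BooleanAlgebra B] (E : Set B) : Prop :=
  ⊤ ∈ E ∧ (∀ a b : B, a ∈ E → a ≤ b → b ∈ E) ∧ ∀ a b : B, a ∈ E → b ∈ E → a ⊓ b ∈ E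

/-- An ultrafilter on a Boolean algebra: a maximal proper filter. -/
def IsBAUltrafilter {B : Type u} [BooleanAlgebra B] (E : Set B) : Prop :=
  IsBAFilter E ∧ ⊥ ∉ E ∧ ∀ E' : Set B, IsBAFilter E' → ⊥ ∉ E' → E ⊆ E' → E' = E

/-- `E` is a `theta`-complete subset of the complete Boolean algebra `B`: every subset of `E`
of cardinality `< theta` has its infimum in `E`. -/
def IsThetaComplete {B : Type u} [CompleteBooleanAlgebra B] (theta : Cardinal.{u})
    (E : Set B) : Prop :=
  ∀ S : Set B, S ⊆ E → #S < theta → sInf S ∈ E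

/-- `X ⊆ B` is `rho⁺`-good: every monotonic `fss(rho)`-indexed sequence of members of `X`
has a multiplicative refinement in `X`. -/
def IsGoodBA {B : Type u} [BooleanAlgebra B] (rho : Cardinal.{u}) (X : Set B) : Prop :=
  ∀ a : Finset Ordinal.{u} → B,
    (∀ u, ↑u ⊆ Set.Iio rho.ord → a u ∈ X) →
    (∀ u v, ↑v ⊆ Set.Iio rho.ord → u ⊆ v → a v ≤ a u) →
    ∃ b : Ordinal.{u} → B, (∀ α, α < rho.ord → b α ∈ X) ∧
      ∀ u : Finset Ordinal.{u}, ↑u ⊆ Set.Iio rho.ord → u.inf b ≤ a u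

/-- `kappa` is a measurable cardinal: uncountable, carrying a nonprincipal `kappa`-complete
ultrafilter. -/
def IsMeasurableCard (kappa : Cardinal.{u}) : Prop :=
  ℵ₀ < kappa ∧ ∃ (K : Type u) (U : Ultrafilter K), #K = kappa ∧
    (∀ a : K, ({a} : Set K) ∉ U) ∧
    ∀ S : Set (Set K), (∀ A ∈ S, A ∈ U) → #S < kappa → ⋂₀ S ∈ U

/-- `kappa` is weakly compact: uncountable and every 2-coloring of pairs of ordinals `< kappa.ord`
has a homogeneous set of cardinality `kappa`. -/
def IsWeaklyCompactCard (kappa : Cardinal.{u}) : Prop :=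
  ℵ₀ < kappa ∧ ∀ c : Ordinal.{u} → Ordinal.{u} → Bool,
    ∃ U : Set Ordinal.{u}, U ⊆ Set.Iio kappa.ord ∧ #U = Cardinal.lift.{u+1} kappa ∧
      ∃ v : Bool, ∀ ε ∈ U, ∀ ζ ∈ U, ε < ζ → c ε ζ = v


section IndependentFamily

variable {I J C : Type u}

/-- The points of `I` that agree with `x` on the coordinates in `s`, when the family `g` is used
to map `I` into `J → C`. -/
def cylinder (g : J → I → C) (s : Finset J) (x : J → C) : Set I := {t | ∀ j ∈ s, g j t = x j}

/-- The family `g` maps `I` onto a dense subset of the product `J → C` of discrete spaces. -/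
def IsDenseFamily (g : J → I → C) : Prop := ∀ s x, (cylinder g s x).Nonempty

theorem cylinder_union [DecidableEq J] (g : J → I → C) (s s' : Finset J) (x : J → C) :
    cylinder g (s ∪ s') x = cylinder g s x ∩ cylinder g s' x := by
  ext t
  simp only [cylinder, mem_ofPred_eq, Finset.mem_union, mem_inter_iff]
  grind

theorem cylinder_congr (g : J → I → C) {s : Finset J} {x y : J → C} (h : ∀ j ∈ s, x j = y j) :
    cylinder g s x = cylinder g s y := by
  ext t
  simp only [cylinder, mem_ofPred_eq]
  exact forall₂_congr fun j hj => by rw [h j hj]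

theorem exists_finset_separating {K : Type u} (s : Finset (Set K)) :
    ∃ F : Finset K, ∀ X ∈ s, ∀ Y ∈ s, (∀ i ∈ F, i ∈ X ↔ i ∈ Y) → X = Y := by
  classical
  have h : ∀ p : Set K × Set K, ∃ F : Finset K, (∀ i ∈ F, i ∈ p.1 ↔ i ∈ p.2) → p.1 = p.2 := by
    intro p
    by_cases hp : p.1 = p.2
    · exact ⟨∅, fun _ => hp⟩
    · obtain ⟨i, hi⟩ : ∃ i, ¬ (i ∈ p.1 ↔ i ∈ p.2) := by
        by_contra! hc
        exact hp (Set.ext hc)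
      exact ⟨{i}, fun hF => absurd (hF i (by simp)) hi⟩
  choose F hF using h
  refine ⟨(s ×ˢ s).biUnion F, fun X hX Y hY hXY => hF (X, Y) fun i hi => hXY i ?_⟩
  exact Finset.mem_biUnion.2 ⟨(X, Y), Finset.mem_product.2 ⟨hX, hY⟩, hi⟩

/-- The Engelking–Karłowicz theorem. -/
theorem exists_isDenseFamily [Infinite I] [Nonempty C] (hC : #C ≤ #I)
    (hJ : #J ≤ (2 : Cardinal.{u}) ^ #I) : ∃ g : J → I → C, IsDenseFamily g := by
  classical
  let _ : Zero C := ⟨Classical.arbitrary C⟩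
  have hcard : #(Finset I × (Finset I →₀ C)) ≤ #I := by
    rw [mk_prod, lift_id, lift_id, mk_finset_of_infinite]
    refine mul_le_of_le (aleph0_le_mk I) le_rfl ?_
    refine (mk_le_of_injective
      (f := fun φ : Finset I →₀ C => φ.graph) (Finsupp.graph_injective _ _)).trans ?_
    rw [mk_finset_of_infinite, mk_prod, lift_id, lift_id, mk_finset_of_infinite]
    exact mul_le_of_le (aleph0_le_mk I) le_rfl hC
  obtain ⟨σ, hσ⟩ : ∃ σ : I → Finset I × (Finset I →₀ C), Function.Surjective σ := by
    obtain ⟨f⟩ := hcard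
    exact ⟨Function.invFun f, Function.invFun_surjective f.injective⟩
  obtain ⟨e⟩ : Nonempty (J ↪ Set I) := by
    rw [← mk_set] at hJ
    exact hJ
  refine ⟨fun j t => (σ t).2 ((σ t).1.filter (· ∈ e j)), fun s x => ?_⟩
  obtain ⟨F, hF⟩ := exists_finset_separating (s.image e)
  have hinj : ∀ j ∈ s, ∀ k ∈ s, F.filter (· ∈ e j) = F.filter (· ∈ e k) → j = k := by
    intro j hj k hk h
    refine e.injective (hF _ (Finset.mem_image_of_mem _ hj) _ (Finset.mem_image_of_mem _ hk) ?_)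
    intro i hi
    have := congrArg (i ∈ ·) h
    simpa [hi] using this
  let φ : Finset I →₀ C := Finsupp.onFinset (s.image fun j => F.filter (· ∈ e j))
    (fun a => if h : ∃ j ∈ s, F.filter (· ∈ e j) = a then x h.choose else 0) (by
      intro a ha
      by_cases h : ∃ j ∈ s, F.filter (· ∈ e j) = a
      · exact Finset.mem_image.2 h
      · simp [h] at ha)
  obtain ⟨t, ht⟩ := hσ (F, φ)
  refine ⟨t, fun j hj => ?_⟩
  have h : ∃ k ∈ s, F.filter (· ∈ e k) = F.filter (· ∈ e j) := ⟨j, hj, rfl⟩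
  simp only [ht]
  change (if h : ∃ k ∈ s, F.filter (· ∈ e k) = F.filter (· ∈ e j) then x h.choose else 0) = x j
  rw [dif_pos h]
  exact congrArg x (hinj _ h.choose_spec.1 _ hj h.choose_spec.2)

/-- Every nonempty cylinder of the family `g` is positive modulo the filter `D`, and `D` is maximal
with this property. -/
structure IsMaximalIndependent (D : Filter I) (g : J → I → C) : Prop where
  frequently : ∀ s x, ∃ᶠ t in D, t ∈ cylinder g s x
  mem_of_frequently : ∀ X : Set I, (∀ s x, ∃ᶠ t in D, t ∈ cylinder g s x ∩ X) → X ∈ D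

theorem IsDenseFamily.exists_isMaximalIndependent {g : J → I → C} (hg : IsDenseFamily g) :
    ∃ D : Filter I, IsMaximalIndependent D g := by
  let P : Filter I → Prop := fun D => ∀ s x, ∃ᶠ t in D, t ∈ cylinder g s x
  obtain ⟨D, hD⟩ : ∃ D : (Filter I)ᵒᵈ, Maximal (fun D => P (OrderDual.ofDual D)) D := by
    refine zorn_le₀ {D : (Filter I)ᵒᵈ | P (OrderDual.ofDual D)} fun c hc hchain => ?_
    rcases c.eq_empty_or_nonempty with rfl | hne
    · refine ⟨OrderDual.toDual ⊤, fun s x => ?_, by simp⟩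
      rw [OrderDual.ofDual_toDual, Filter.frequently_top]
      exact hg s x
    · refine ⟨OrderDual.toDual (⨅ D : c, OrderDual.ofDual D.1), fun s x => ?_, fun D hD => ?_⟩
      · have := hne.to_subtype
        rw [OrderDual.ofDual_toDual, Filter.Frequently, Filter.eventually_iff,
          Filter.mem_iInf_of_directed]
        · rintro ⟨D, hD⟩
          exact hc D.2 s x hD
        · intro a b
          rcases hchain.total a.2 b.2 with h | h
          · exact ⟨b, h, le_rfl⟩
          · exact ⟨a, le_rfl, h⟩
      · exact iInf_le (fun D : c => OrderDual.ofDual D.1) ⟨D, hD⟩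
  refine ⟨OrderDual.ofDual D, hD.prop, fun X hX => ?_⟩
  have h := hD.le_of_ge (y := OrderDual.toDual (OrderDual.ofDual D ⊓ Filter.principal X)) ?_ ?_
  · have h' : OrderDual.ofDual D ≤ OrderDual.ofDual D ⊓ Filter.principal X := h
    exact Filter.le_principal_iff.1 (h'.trans inf_le_right)
  · intro s x
    have := hX s x
    rw [OrderDual.ofDual_toDual, Filter.frequently_inf_principal]
    exact this.mono fun t ht => ⟨ht.2, ht.1⟩
  · exact inf_le_left (a := OrderDual.ofDual D)

/-- `A` is contained in `X` or disjoint from `X`, modulo `D`. -/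
def Decides (D : Filter I) (A X : Set I) : Prop :=
  (∀ᶠ t in D, t ∈ A → t ∈ X) ∨ ∀ᶠ t in D, t ∈ A → t ∉ X

theorem Decides.anti {D : Filter I} {A B X : Set I} (h : Decides D A X) (hB : B ⊆ A) :
    Decides D B X :=
  h.imp (fun h => h.mono fun _ ht hb => ht (hB hb)) fun h => h.mono fun _ ht hb => ht (hB hb)

/-- The cylinders over finite subsets of `S` that decide `X` modulo `D` are predense. -/
def SupportedOn (D : Filter I) (g : J → I → C) (S : Set J) (X : Set I) : Prop :=
  ∀ (s : Finset J) (x : J → C), ∃ y : J → C, (∀ j ∈ s, y j = x j) ∧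
    ∃ s' : Finset J, ↑s' ⊆ S ∧ Decides D (cylinder g s' y) X

namespace IsMaximalIndependent

variable {D : Filter I} {g : J → I → C}

theorem exists_decides (h : IsMaximalIndependent D g) (X : Set I) (s : Finset J) (x : J → C) :
    ∃ y : J → C, (∀ j ∈ s, y j = x j) ∧ ∃ s', Decides D (cylinder g s' y) X := by
  classical
  by_contra! hc
  have hY : X ∪ (cylinder g s x)ᶜ ∈ D := by
    refine h.mem_of_frequently _ fun s' y => ?_
    by_cases hy : ∃ j ∈ s, j ∈ s' ∧ y j ≠ x j
    · obtain ⟨j, hj, hj', hne⟩ := hy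
      refine (h.frequently s' y).mono fun t ht => ⟨ht, Or.inr fun ht' => hne ?_⟩
      rw [← ht j hj', ht' j hj]
    · push Not at hy
      have h1 := hc (fun j => if j ∈ s then x j else y j) (fun j hj => by simp [hj]) s'
      rw [cylinder_congr g (y := y) (fun j hj => by grind)] at h1
      have h2 : ∃ᶠ t in D, t ∈ cylinder g s' y ∧ t ∈ X := by
        by_contra hf
        exact h1 (Or.inr ((Filter.not_frequently.1 hf).mono fun t ht h1 h2 => ht ⟨h1, h2⟩))
      exact h2.mono fun t ht => ⟨ht.1, Or.inl ht.2⟩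
  exact hc x (fun _ _ => rfl) s (Or.inl (Filter.mem_of_superset hY fun t ht hts =>
    ht.resolve_right fun hn => hn hts))

theorem exists_supportedOn [Infinite I] (h : IsMaximalIndependent D g) (X : Set I) :
    ∃ S : Set J, #S ≤ #I ∧ SupportedOn D g S X := by
  classical
  have hne : ∀ s x, (cylinder g s x).Nonempty := fun s x => (h.frequently s x).exists
  let P : Set (Set (Finset J × (J → C))) := {𝒜 | (∀ p ∈ 𝒜, Decides D (cylinder g p.1 p.2) X) ∧
    𝒜.PairwiseDisjoint fun p => cylinder g p.1 p.2}
  obtain ⟨𝒜, h𝒜⟩ : ∃ 𝒜, Maximal (· ∈ P) 𝒜 := by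
    refine zorn_subset P fun c hc hchain => ⟨⋃₀ c, ⟨?_, ?_⟩, fun _ => subset_sUnion_of_mem⟩
    · rintro p ⟨a, ha, hp⟩
      exact (hc ha).1 p hp
    · exact (pairwiseDisjoint_sUnion hchain.directedOn).2 fun a ha => (hc ha).2
  refine ⟨⋃ p ∈ 𝒜, ↑p.1, ?_, fun s x => ?_⟩
  · have hcard : #𝒜 ≤ #I := by
      choose f hf using hne
      refine mk_le_of_injective (f := fun p : 𝒜 => f p.1.1 p.1.2) fun p q hpq => ?_
      by_contra hn
      refine Set.disjoint_left.1 (h𝒜.prop.2 p.2 q.2 (Subtype.coe_ne_coe.2 hn))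
        (hf p.1.1 p.1.2) ?_
      simp only at hpq
      rw [hpq]
      exact hf _ _
    rw [biUnion_eq_iUnion]
    refine (mk_iUnion_le _).trans (mul_le_of_le (aleph0_le_mk I) hcard ?_)
    exact ciSup_le' fun p => (lt_aleph0_of_finite _).le.trans (aleph0_le_mk I)
  · obtain ⟨y, hy, s', hs'⟩ := h.exists_decides X s x
    have hdec : Decides D (cylinder g (s ∪ s') y) X :=
      hs'.anti (by rw [cylinder_union]; exact inter_subset_right)
    obtain ⟨p, hp, t, ht1, ht2⟩ :
        ∃ p ∈ 𝒜, (cylinder g (s ∪ s') y ∩ cylinder g p.1 p.2).Nonempty := by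
      by_contra! hc
      have hmem : insert (s ∪ s', y) 𝒜 ∈ P := by
        refine ⟨?_, ?_⟩
        · rintro p (rfl | hp)
          exacts [hdec, h𝒜.prop.1 p hp]
        · exact h𝒜.prop.2.insert fun p hp _ => Set.disjoint_iff_inter_eq_empty.2 (hc p hp)
      have := h𝒜.le_of_ge hmem (subset_insert _ _) (mem_insert _ _)
      have h1 := hc _ this
      rw [inter_self] at h1
      exact (hne _ _).ne_empty h1
    refine ⟨fun j => g j t, fun j hj => ?_, p.1,
      subset_biUnion_of_mem (u := fun p => (↑p.1 : Set J)) hp, ?_⟩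
    · rw [← hy j hj]
      exact ht1 j (Finset.mem_union_left _ hj)
    · rw [cylinder_congr g (y := p.2) ht2]
      exact h𝒜.prop.1 p hp

/-- A positive set supported on `S` meets every cylinder with coordinates outside `S`. -/
theorem inter_cylinder_nonempty (h : IsMaximalIndependent D g) {S : Set J} {X : Set I}
    (hX : SupportedOn D g S X) (hpos : ∃ᶠ t in D, t ∈ X) {s : Finset J} (hs : ∀ j ∈ s, j ∉ S)
    (x : J → C) : (X ∩ cylinder g s x).Nonempty := by
  classical
  obtain ⟨s₀, x₀, hs₀⟩ : ∃ s₀ x₀, ∀ᶠ t in D, t ∈ cylinder g s₀ x₀ → t ∈ X := by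
    by_contra! hc
    have := h.mem_of_frequently Xᶜ fun s x => by
      refine (Filter.not_eventually.1 (hc s x)).mono fun t ht => ?_
      push Not at ht
      exact ht
    exact hpos this
  obtain ⟨y, hy, s', hs', hdec⟩ := hX s₀ x₀
  rcases hdec with hdec | hdec
  · have h1 := h.frequently (s' ∪ s) (fun j => if j ∈ S then y j else x j)
    rw [cylinder_union, cylinder_congr g (y := y) (fun j hj => if_pos (hs' hj)),
      cylinder_congr g (y := x) (fun j hj => if_neg (hs j hj))] at h1
    obtain ⟨t, ht, ht'⟩ := (h1.and_eventually hdec).exists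
    exact ⟨t, ht' ht.1, ht.2⟩
  · have h1 := h.frequently (s₀ ∪ s') y
    rw [cylinder_union, cylinder_congr g hy] at h1
    obtain ⟨t, ht, ht1, ht2⟩ := (h1.and_eventually (hs₀.and hdec)).exists
    exact absurd (ht1 ht.1) (ht2 ht.2)

end IsMaximalIndependent

namespace SupportedOn

variable {D : Filter I} {g : J → I → C} {S S' : Set J} {X Y : Set I}

theorem mono (h : SupportedOn D g S X) (hS : S ⊆ S') : SupportedOn D g S' X := fun s x =>
  let ⟨y, hy, s', hs', hd⟩ := h s x
  ⟨y, hy, s', hs'.trans hS, hd⟩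

theorem of_mem (hX : X ∈ D) : SupportedOn D g S X := fun _ x =>
  ⟨x, fun _ _ => rfl, ∅, by simp, Or.inl (Filter.mem_of_superset hX fun _ ht _ => ht)⟩

theorem compl (h : SupportedOn D g S X) : SupportedOn D g S Xᶜ := fun s x =>
  let ⟨y, hy, s', hs', hd⟩ := h s x
  ⟨y, hy, s', hs', hd.symm.imp id fun h => h.mono fun _ ht hA hX => hX (ht hA)⟩

theorem inter (hX : SupportedOn D g S X) (hY : SupportedOn D g S Y) :
    SupportedOn D g S (X ∩ Y) := by
  classical
  intro s x
  obtain ⟨y, hy, s₁, hs₁, h₁⟩ := hX s x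
  obtain ⟨z, hz, s₂, hs₂, h₂⟩ := hY (s ∪ s₁) y
  refine ⟨z, fun j hj => (hz j (Finset.mem_union_left _ hj)).trans (hy j hj), s₁ ∪ s₂,
    by simp [hs₁, hs₂], ?_⟩
  rw [← cylinder_congr g fun j hj => hz j (Finset.mem_union_right _ hj)] at h₁
  rw [cylinder_union]
  rcases h₁ with h₁ | h₁
  · rcases h₂ with h₂ | h₂
    · exact Or.inl ((h₁.and h₂).mono fun t ht hA => ⟨ht.1 hA.1, ht.2 hA.2⟩)
    · exact Or.inr (h₂.mono fun t ht hA hXY => ht hA.2 hXY.2)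
  · exact Or.inr (h₁.mono fun t ht hA hXY => ht hA.1 hXY.1)

theorem sInter {T : Set (Set I)} (hT : T.Finite) (h : ∀ X ∈ T, SupportedOn D g S X) :
    SupportedOn D g S (⋂₀ T) := by
  induction T, hT using Set.Finite.induction_on with
  | empty => rw [sInter_empty]; exact of_mem Filter.univ_mem
  | insert _ _ ih =>
    rw [sInter_insert]
    exact (h _ (mem_insert _ _)).inter (ih fun X hX => h X (mem_insert_of_mem _ hX))

/-- Substituting a coordinate function for the second argument of a relation. -/
theorem setOf_apply {φ : I → C → Prop} (h : ∀ c, SupportedOn D g S {t | φ t c}) {j : J}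
    (hS : S ⊆ S') (hj : j ∈ S') : SupportedOn D g S' {t | φ t (g j t)} := by
  classical
  intro s x
  obtain ⟨y, hy, s', hs', hd⟩ := h (x j) (insert j s) x
  refine ⟨y, fun k hk => hy k (Finset.mem_insert_of_mem hk), insert j s', ?_, ?_⟩
  · rw [Finset.coe_insert]
    exact insert_subset hj (hs'.trans hS)
  · have hsub : cylinder g (insert j s') y ⊆ cylinder g s' y :=
      fun t ht k hk => ht k (Finset.mem_insert_of_mem hk)
    have hval : ∀ t ∈ cylinder g (insert j s') y, g j t = x j :=
      fun t ht => (ht j (Finset.mem_insert_self _ _)).trans (hy j (Finset.mem_insert_self _ _))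
    refine (hd.anti hsub).imp (fun h => h.mono fun t ht hA => ?_) fun h => h.mono fun t ht hA => ?_
    · simpa [hval t hA] using ht hA
    · simpa [hval t hA] using ht hA

end SupportedOn

end IndependentFamily

section Realization

variable {I C P W : Type u}

/-- The relations in `Φ` are represented in `B`, and every finite part of `Φ` is satisfied by some
constant `c` on a set in `V`. -/
def FinitelySatisfiable (Φ : Set (I → C → Prop)) (V B : Set (Set I)) : Prop :=
  (∀ φ ∈ Φ, ∀ c, {t | φ t c} ∈ B) ∧
    ∀ T : Finset (I → C → Prop), ↑T ⊆ Φ → ∃ c, {t | ∀ φ ∈ T, φ t c} ∈ V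

/-- The sets supported on coordinates of rank below `α`. -/
def setsBelow [LT W] (D : Filter I) (g : W × P → I → C) (α : W) : Set (Set I) :=
  {X | SupportedOn D g {j | j.1 < α} X}

/-- The sets that have to be added at rank `α` in order to realize the finitely satisfiable
types among `Φ p V`. -/
def realizers [LT W] (D : Filter I) (g : W × P → I → C) (Φ : P → Set (Set I) → Set (I → C → Prop))
    (α : W) (V : Set (Set I)) : Set (Set I) :=
  {Y | ∃ p, FinitelySatisfiable (Φ p V) V (setsBelow D g α) ∧ ∃ φ ∈ Φ p V,
    Y = {t | φ t (g (α, p) t)}}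

theorem setsBelow_mono [Preorder W] (D : Filter I) (g : W × P → I → C) :
    Monotone (setsBelow D g) :=
  fun _ _ h _ hX => SupportedOn.mono hX fun _ hj => lt_of_lt_of_le hj h

theorem realizers_subset [Preorder W] (D : Filter I) (g : W × P → I → C)
    (Φ : P → Set (Set I) → Set (I → C → Prop)) {α β : W} (h : α < β) (V : Set (Set I)) :
    realizers D g Φ α V ⊆ setsBelow D g β := by
  rintro _ ⟨p, hp, φ, hφ, rfl⟩
  exact SupportedOn.setOf_apply (fun c => hp.1 φ hφ c) (fun j hj => lt_trans hj h) h

theorem IsMaximalIndependent.inter_sInter_realizers_nonempty [Preorder W] {D : Filter I}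
    {g : W × P → I → C} (hD : IsMaximalIndependent D g)
    (Φ : P → Set (Set I) → Set (I → C → Prop)) {α : W} {U : Ultrafilter I} (hU : ↑U ≤ D)
    {X : Set I} (hXU : X ∈ U) (hX : X ∈ setsBelow D g α) {T : Set (Set I)} (hT : T.Finite)
    (hTr : T ⊆ realizers D g Φ α ((U : Filter I).sets ∩ setsBelow D g α)) :
    (X ∩ ⋂₀ T).Nonempty := by
  classical
  set V := (U : Filter I).sets ∩ setsBelow D g α
  rcases isEmpty_or_nonempty P with hP | hP
  · obtain ⟨t, ht⟩ := U.nonempty_of_mem hXU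
    exact ⟨t, ht, fun Y hY => (hP.false (hTr hY).choose).elim⟩
  replace hTr : ∀ Y ∈ T, ∃ p, FinitelySatisfiable (Φ p V) V (setsBelow D g α) ∧
      ∃ φ ∈ Φ p V, Y = {t | φ t (g (α, p) t)} := fun Y hY => hTr hY
  choose! p hp φ hφ hY using hTr
  have hc : ∀ q : P, ∃ c, FinitelySatisfiable (Φ q V) V (setsBelow D g α) →
      {t | ∀ ψ ∈ (hT.toFinset.filter (p · = q)).image φ, ψ t c} ∈ V := by
    intro q
    by_cases hq : FinitelySatisfiable (Φ q V) V (setsBelow D g α)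
    · obtain ⟨c, hc⟩ := hq.2 ((hT.toFinset.filter (p · = q)).image φ) (by
        intro ψ hψ
        simp only [Finset.coe_image, Finset.coe_filter, mem_image] at hψ
        obtain ⟨Y, ⟨hY, rfl⟩, rfl⟩ := hψ
        exact hφ Y (hT.mem_toFinset.1 hY))
      exact ⟨c, fun _ => hc⟩
    · have : Nonempty C := by
        obtain ⟨t, -⟩ := U.nonempty_of_mem hXU
        exact ⟨g (α, q) t⟩
      exact ⟨Classical.arbitrary C, fun h => absurd h hq⟩
  choose c hc using hc
  let Z : Set (Set I) := (fun q => {t | ∀ ψ ∈ (hT.toFinset.filter (p · = q)).image φ, ψ t (c q)}) ''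
    (p '' T)
  have hZfin : Z.Finite := (hT.image p).image _
  have hZ : ∀ Y ∈ Z, Y ∈ V := by
    rintro _ ⟨_, ⟨Y, hYT, rfl⟩, rfl⟩
    exact hc _ (hp Y hYT)
  have hpos : ∃ᶠ t in D, t ∈ X ∩ ⋂₀ Z := by
    have : X ∩ ⋂₀ Z ∈ U := Filter.inter_mem hXU
      ((Filter.sInter_mem hZfin).2 fun Y hY => (hZ Y hY).1)
    exact (Ultrafilter.frequently_iff_eventually.2 this).filter_mono hU
  obtain ⟨t, ⟨htX, htZ⟩, ht⟩ := hD.inter_cylinder_nonempty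
    (SupportedOn.inter hX (SupportedOn.sInter hZfin fun Y hY => (hZ Y hY).2)) hpos
    (s := (hT.toFinset.image p).image fun q => (α, q)) (by
      intro j hj
      obtain ⟨q, -, rfl⟩ := Finset.mem_image.1 hj
      exact lt_irrefl α) (fun j => c j.2)
  refine ⟨t, htX, fun Y hYT => ?_⟩
  rw [hY Y hYT]
  have h1 : g (α, p Y) t = c (p Y) := ht (α, p Y) (Finset.mem_image_of_mem _
    (Finset.mem_image_of_mem _ (hT.mem_toFinset.2 hYT)))
  have h2 := htZ _ ⟨_, ⟨Y, hYT, rfl⟩, rfl⟩ (φ Y) (Finset.mem_image_of_mem _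
    (Finset.mem_filter.2 ⟨hT.mem_toFinset.2 hYT, rfl⟩))
  change φ Y t (g (α, p Y) t)
  rw [h1]
  exact h2

theorem IsMaximalIndependent.exists_ultrafilter_realizing [LinearOrder W] [WellFoundedLT W]
    [Nonempty I] {D : Filter I} {g : W × P → I → C} (hD : IsMaximalIndependent D g)
    (Φ : P → Set (Set I) → Set (I → C → Prop)) :
    ∃ U : Ultrafilter I, ∀ α,
      realizers D g Φ α ((U : Filter I).sets ∩ setsBelow D g α) ⊆ (U : Filter I).sets := by
  classical
  have : D.NeBot := by
    rcases isEmpty_or_nonempty (W × P → C) with hC | ⟨⟨x⟩⟩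
    · obtain ⟨t⟩ := ‹Nonempty I›
      exact (hC.false fun j => g j t).elim
    · exact Filter.frequently_true_iff_neBot D |>.1 ((hD.frequently ∅ x).mono fun _ _ => trivial)
  let S : W → Ultrafilter I → Set (Set I) := fun α U =>
    ((U : Filter I).sets ∩ setsBelow D g α) ∪
      realizers D g Φ α ((U : Filter I).sets ∩ setsBelow D g α)
  let e : Set (Set I) → Ultrafilter I := fun 𝒮 =>
    if h : (Filter.generate 𝒮).NeBot then Ultrafilter.of (Filter.generate 𝒮)
    else pure (Classical.arbitrary I)
  obtain ⟨U, hU⟩ : ∃ U : W → Ultrafilter I,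
      ∀ α, U α = e (D.sets ∪ ⋃ β, ⋃ _ : β < α, S β (U β)) :=
    ⟨wellFounded_lt.fix fun α U => e (D.sets ∪ ⋃ β, ⋃ h : β < α, S β (U β h)),
      fun α => by rw [WellFounded.fix_eq]⟩
  have he : ∀ 𝒮, (Filter.generate 𝒮).NeBot → 𝒮 ⊆ (e 𝒮 : Filter I).sets := by
    intro 𝒮 h X hX
    simp only [e, dif_pos h]
    exact Ultrafilter.of_le _ (Filter.GenerateSets.basic hX)
  have hS : ∀ {α β}, β < α → S β (U β) ⊆ setsBelow D g α := fun h =>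
    union_subset (inter_subset_right.trans (setsBelow_mono D g h.le))
      (realizers_subset D g Φ h _)
  have hstep : ∀ α, D.sets ∪ ⋃ β, ⋃ _ : β < α, S β (U β) ⊆ (U α : Filter I).sets →
      ∀ T : Set (Set I), T ⊆ D.sets ∪ ⋃ β, ⋃ _ : β ≤ α, S β (U β) → T.Finite →
      (⋂₀ T).Nonempty := by
    intro α hα T hT hfin
    have hUD : ↑(U α) ≤ D := fun X hX => hα (Or.inl hX)
    have hsplit : ∀ Y ∈ T, Y ∈ (U α : Filter I).sets ∩ setsBelow D g α ∨
        Y ∈ realizers D g Φ α ((U α : Filter I).sets ∩ setsBelow D g α) := by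
      intro Y hY
      rcases hT hY with h | h
      · exact Or.inl ⟨hUD h, SupportedOn.of_mem h⟩
      · simp only [mem_iUnion] at h
        obtain ⟨β, hβ, h⟩ := h
        rcases hβ.eq_or_lt with rfl | hlt
        · exact h
        · refine Or.inl ⟨hα (Or.inr ?_), hS hlt h⟩
          simp only [mem_iUnion]
          exact ⟨β, hlt, h⟩
    obtain ⟨t, ht, ht'⟩ := hD.inter_sInter_realizers_nonempty Φ (α := α) hUD
      (X := ⋂₀ {Y ∈ T | Y ∈ (U α : Filter I).sets ∩ setsBelow D g α})
      ((Filter.sInter_mem (hfin.subset (sep_subset _ _))).2 fun Y hY => hY.2.1)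
      (SupportedOn.sInter (hfin.subset (sep_subset _ _)) fun Y hY => hY.2.2)
      (T := {Y ∈ T | Y ∈ realizers D g Φ α ((U α : Filter I).sets ∩ setsBelow D g α)})
      (hfin.subset (sep_subset _ _)) fun Y hY => hY.2
    exact ⟨t, fun Y hY => (hsplit Y hY).elim (fun h => ht Y ⟨hY, h⟩) fun h => ht' Y ⟨hY, h⟩⟩
  have hbound : ∀ (L : Set W) (T : Set (Set I)), T.Finite →
      T ⊆ D.sets ∪ ⋃ β ∈ L, S β (U β) →
      T ⊆ D.sets ∨ ∃ α ∈ L, T ⊆ D.sets ∪ ⋃ β, ⋃ _ : β ≤ α, S β (U β) := by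
    intro L T hfin
    induction T, hfin using Set.Finite.induction_on with
    | empty => exact fun _ => Or.inl (empty_subset _)
    | @insert X T _ _ ih =>
      intro hT
      have hmono : ∀ {α β : W}, α ≤ β → (D.sets ∪ ⋃ γ, ⋃ _ : γ ≤ α, S γ (U γ)) ⊆
          D.sets ∪ ⋃ γ, ⋃ _ : γ ≤ β, S γ (U γ) := fun h => union_subset_union_right _
        (iUnion_mono fun γ => iUnion_subset fun hγ => subset_iUnion_of_subset (hγ.trans h) le_rfl)
      have hX : X ∈ D.sets ∨ ∃ α ∈ L, X ∈ D.sets ∪ ⋃ β, ⋃ _ : β ≤ α, S β (U β) := by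
        refine (hT (mem_insert _ _)).imp id fun h => ?_
        simp only [mem_iUnion] at h
        obtain ⟨β, hβ, h⟩ := h
        refine ⟨β, hβ, Or.inr ?_⟩
        simp only [mem_iUnion]
        exact ⟨β, le_rfl, h⟩
      rcases hX with hX | ⟨α, hα, hX⟩ <;>
        rcases ih ((subset_insert _ _).trans hT) with hT' | ⟨β, hβ, hT'⟩
      · exact Or.inl (insert_subset hX hT')
      · exact Or.inr ⟨β, hβ, insert_subset (Or.inl hX) hT'⟩
      · exact Or.inr ⟨α, hα, insert_subset hX (hT'.trans subset_union_left)⟩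
      · rcases le_total α β with h | h
        · exact Or.inr ⟨β, hβ, insert_subset (hmono h hX) hT'⟩
        · exact Or.inr ⟨α, hα, insert_subset hX (hT'.trans (hmono h))⟩
  have hgen : ∀ L : Set W,
      (∀ α ∈ L, D.sets ∪ ⋃ β, ⋃ _ : β < α, S β (U β) ⊆ (U α : Filter I).sets) →
      (Filter.generate (D.sets ∪ ⋃ β ∈ L, S β (U β))).NeBot := by
    intro L hL
    refine Filter.generate_neBot_iff.2 fun T hT hfin => ?_
    rcases hbound L T hfin hT with h | ⟨α, hα, h⟩
    · exact Filter.nonempty_of_mem ((Filter.sInter_mem hfin).2 h)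
    · exact hstep α (hL α hα) T h hfin
  have hall : ∀ α, D.sets ∪ ⋃ β, ⋃ _ : β < α, S β (U β) ⊆ (U α : Filter I).sets := by
    intro α
    induction α using WellFoundedLT.induction with
    | ind α ih =>
      conv_rhs => rw [hU α]
      exact he _ (hgen (Iio α) ih)
  have hfinal := he _ (hgen Set.univ fun α _ => hall α)
  refine ⟨e (D.sets ∪ ⋃ β ∈ Set.univ, S β (U β)), fun α => ?_⟩
  set E := e (D.sets ∪ ⋃ β ∈ Set.univ, S β (U β))
  have hE : S α (U α) ⊆ (E : Filter I).sets := fun X hX => @hfinal X (Or.inr (by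
    simp only [mem_iUnion]
    exact ⟨α, mem_univ _, hX⟩))
  have heq : (E : Filter I).sets ∩ setsBelow D g α = (U α : Filter I).sets ∩ setsBelow D g α := by
    ext X
    refine ⟨fun hX => ⟨?_, hX.2⟩, fun hX => ⟨hE (Or.inl hX), hX.2⟩⟩
    by_contra hn
    have hc : Xᶜ ∈ (E : Filter I) :=
      hE (Or.inl ⟨Ultrafilter.compl_mem_iff_notMem.2 hn, SupportedOn.compl hX.2⟩)
    exact Ultrafilter.compl_mem_iff_notMem.1 hc hX.1
  rw [heq]
  exact subset_union_right.trans hE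

/-- An ultrafilter realizing prescribed types over the members of a cofinal chain of families of
sets. -/
theorem exists_ultrafilter_realizing [LinearOrder W] [WellFoundedLT W] [Infinite I] [Nonempty C]
    (hC : #C ≤ #I) (hP : #P ≤ (2 : Cardinal.{u}) ^ #I) (hW : #W ≤ (2 : Cardinal.{u}) ^ #I)
    (hcof : ∀ S : Set W, #S ≤ #I → ∃ α, ∀ β ∈ S, β < α)
    (Φ : P → Set (Set I) → Set (I → C → Prop)) :
    ∃ (U : Ultrafilter I) (B : W → Set (Set I)) (g : W → P → I → C), Monotone B ∧
      (∀ α, Set.univ ∈ B α) ∧ (∀ α, ∅ ∈ B α) ∧ (∀ α T, T.Finite → T ⊆ B α → ⋂₀ T ∈ B α) ∧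
      (∀ 𝒳 : Set (Set I), #𝒳 ≤ #I → ∃ α, 𝒳 ⊆ B α) ∧
      ∀ α p, FinitelySatisfiable (Φ p ((U : Filter I).sets ∩ B α))
          ((U : Filter I).sets ∩ B α) (B α) →
        ∀ φ ∈ Φ p ((U : Filter I).sets ∩ B α), ∀ᶠ t in U, φ t (g α p t) := by
  have hJ : #(W × P) ≤ (2 : Cardinal.{u}) ^ #I := by
    rw [mk_prod, lift_id, lift_id]
    exact mul_le_of_le ((aleph0_le_mk I).trans (cantor _).le) hW hP
  obtain ⟨g, hg⟩ := exists_isDenseFamily (I := I) (J := W × P) hC hJ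
  obtain ⟨D, hD⟩ := hg.exists_isMaximalIndependent
  obtain ⟨U, hU⟩ := hD.exists_ultrafilter_realizing Φ
  refine ⟨U, setsBelow D g, fun α p => g (α, p), setsBelow_mono D g,
    fun α => SupportedOn.of_mem Filter.univ_mem, fun α => ?_,
    fun α T hT h => SupportedOn.sInter hT h, fun 𝒳 h𝒳 => ?_, fun α p hp φ hφ => ?_⟩
  · rw [← compl_univ]
    exact SupportedOn.compl (SupportedOn.of_mem Filter.univ_mem)
  · choose S hS hX using hD.exists_supportedOn
    have hcard : #(⋃ X ∈ 𝒳, Prod.fst '' S X : Set W) ≤ #I := by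
      rw [biUnion_eq_iUnion]
      exact (mk_iUnion_le _).trans (mul_le_of_le (aleph0_le_mk I) h𝒳
        (ciSup_le' fun X => mk_image_le.trans (hS X)))
    obtain ⟨α, hα⟩ := hcof _ hcard
    refine ⟨α, fun X hX𝒳 => (hX X).mono fun j hj => hα _ ?_⟩
    exact mem_biUnion hX𝒳 (mem_image_of_mem _ hj)
  · exact hU α ⟨p, hp, φ, hφ, rfl⟩

end Realization

section Applications

theorem FinitelySatisfiable.of_eventually {I C : Type u} {U : Ultrafilter I} {B : Set (Set I)}
    {Φ : Set (I → C → Prop)} (hB : ∀ T : Set (Set I), T.Finite → T ⊆ B → ⋂₀ T ∈ B)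
    (h₁ : ∀ φ ∈ Φ, ∀ c, {t | φ t c} ∈ B)
    (h₂ : ∀ T : Finset (I → C → Prop), ↑T ⊆ Φ → ∃ c, ∀ φ ∈ T, ∀ᶠ t in U, φ t c) :
    FinitelySatisfiable Φ ((U : Filter I).sets ∩ B) B := by
  refine ⟨h₁, fun T hT => ?_⟩
  obtain ⟨c, hc⟩ := h₂ T hT
  refine ⟨c, (Filter.eventually_all_finset T).2 hc, ?_⟩
  have : {t | ∀ φ ∈ T, φ t c} = ⋂₀ ((fun φ : I → C → Prop => {t | φ t c}) '' ↑T) := by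
    ext t
    simp
  rw [this]
  refine hB _ (T.finite_toSet.image _) ?_
  rintro _ ⟨φ, hφ, rfl⟩
  exact h₁ φ (hT hφ) c

theorem Cardinal.IsRegular.exists_forall_lt {κ : Cardinal.{u}} (hκ : κ.IsRegular)
    (S : Set κ.ord.ToType) (hS : #S < κ) : ∃ α, ∀ β ∈ S, β < α := by
  have h : ¬ IsCofinal S := fun h => by
    have := Order.cof_le h
    rw [Ordinal.cof_toType, hκ.cof_ord] at this
    exact hS.not_ge this
  simpa [IsCofinal] using h

/-- An ultrafilter `E` on `I` that is `#I`-regular and for which `ℕ^I / E` fills all pre-cuts with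
at most `#I` elements on either side. -/
theorem exists_ultrafilter_filling_cuts (I : Type u) [Infinite I] :
    ∃ E : Ultrafilter I,
      (∃ X : I → Set I, (∀ i, X i ∈ E) ∧ ∀ t, {i | t ∈ X i}.Finite) ∧
      ∀ a b : I → I → ℕ, (∀ i j, ltD (E : Filter I) (a i) (b j)) →
        ∃ c : I → ℕ, (∀ i, leD (E : Filter I) (a i) c) ∧ ∀ j, ltD (E : Filter I) c (b j) := by
  classical
  have hI := aleph0_le_mk I
  have hreg := isRegular_succ hI
  let P := (I → I → ℕ) × (I → I → ℕ)
  have hP' : #(I → I → ℕ) ≤ (2 : Cardinal.{u}) ^ #I := by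
    simp only [mk_pi, prod_const, lift_id, mk_nat, lift_aleph0, lift_uzero]
    rw [← power_mul, mul_eq_self hI, power_eq_two_power hI (natCast_lt_aleph0 (n := 2)).le hI]
  have hP : #P ≤ (2 : Cardinal.{u}) ^ #I := by
    rw [mk_prod, lift_id]
    exact mul_le_of_le (hI.trans (cantor _).le) hP' hP'
  let Φ : P → Set (Set I) → Set (I → Finset I → Prop) := fun p _ =>
    {φ | (∃ i, φ = fun _ u => i ∈ u) ∨ ∃ j, φ = fun t u => ∀ i ∈ u, p.1 i t < p.2 j t}
  obtain ⟨E, B, g, hmono, huniv, hempty, hinter, hcof, hreal⟩ :=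
    exists_ultrafilter_realizing (I := I) (C := Finset I) (P := P) (W := (Order.succ #I).ord.ToType)
      (mk_finset_of_infinite I).le hP
      (by rw [mk_toType, card_ord]; exact Order.succ_le_of_lt (cantor _))
      (fun S hS => hreg.exists_forall_lt S (hS.trans_lt (Order.lt_succ _))) Φ
  have key : ∀ a b : I → I → ℕ, (∀ i j, ltD (E : Filter I) (a i) (b j)) →
      ∃ f : I → Finset I, (∀ i, ∀ᶠ t in E, i ∈ f t) ∧
        ∀ j, ∀ᶠ t in E, ∀ i ∈ f t, a i t < b j t := by
    intro a b hab
    obtain ⟨α, hα⟩ := hcof (range fun q : I × I => {t | a q.1 t < b q.2 t})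
      (mk_range_le.trans (by simp))
    have hfs : FinitelySatisfiable (Φ (a, b) ((E : Filter I).sets ∩ B α))
        ((E : Filter I).sets ∩ B α) (B α) := by
      refine .of_eventually (hinter α) ?_ fun T hT => ?_
      · rintro _ (⟨i, rfl⟩ | ⟨j, rfl⟩) u
        · by_cases hi : i ∈ u
          · simpa [hi] using huniv α
          · simpa [hi] using hempty α
        · have : {t | ∀ i ∈ u, a i t < b j t} = ⋂₀ ((fun i => {t | a i t < b j t}) '' ↑u) := by
            ext t
            simp
          simp only [this]
          refine hinter α _ (u.finite_toSet.image _) ?_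
          rintro _ ⟨i, -, rfl⟩
          exact hα ⟨(i, j), rfl⟩
      · let i₀ : I := Classical.arbitrary I
        refine ⟨T.image fun φ => if h : ∃ i, φ = fun _ u => i ∈ u then h.choose else i₀,
          fun φ hφ => ?_⟩
        by_cases h : ∃ i, φ = fun _ u => i ∈ u
        · have hmem : h.choose ∈ T.image fun φ =>
              if h : ∃ i, φ = fun _ u => i ∈ u then h.choose else i₀ :=
            Finset.mem_image.2 ⟨φ, hφ, dif_pos h⟩
          refine Filter.Eventually.of_forall fun t => ?_
          rw [h.choose_spec]
          exact hmem
        · rcases hT hφ with h' | ⟨j, rfl⟩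
          · exact absurd h' h
          · exact (Filter.eventually_all_finset _).2 fun i _ => hab i j
    exact ⟨g α (a, b), fun i => hreal α (a, b) hfs _ (Or.inl ⟨i, rfl⟩),
      fun j => hreal α (a, b) hfs _ (Or.inr ⟨j, rfl⟩)⟩
  refine ⟨E, ?_, fun a b hab => ?_⟩
  · obtain ⟨f, hf, -⟩ := key (fun _ _ => 0) (fun _ _ => 1)
      fun i j => Filter.Eventually.of_forall fun t => zero_lt_one
    exact ⟨fun i => {t | i ∈ f t}, hf, fun t => (f t).finite_toSet⟩
  · obtain ⟨f, hf, hf'⟩ := key a b hab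
    refine ⟨fun t => (f t).sup fun i => a i t, fun i => ?_, fun j => ?_⟩
    · exact (hf i).mono fun t ht => Finset.le_sup (f := fun i => a i t) ht
    · refine ((hf' j).and (hf (Classical.arbitrary I))).mono fun t ht => ?_
      exact (Finset.sup_lt_iff ((Nat.zero_le _).trans_lt (ht.1 _ ht.2))).2 ht.1

/-- `g` is a sequence of `D`-nonstandard functions that is eventually below every `D`-nonstandard
function. -/
def IsNonstandardScale {I W : Type u} [Preorder W] (D : Filter I) (g : W → I → ℕ) : Prop :=
  (∀ α, IsNonstandard D (g α)) ∧ ∀ f, IsNonstandard D f → ∃ α, ∀ β, α ≤ β → ltD D (g β) f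

theorem IsNonstandardScale.lcfAleph0_eq {I : Type u} {D : Filter I} [D.NeBot]
    {θ : Cardinal.{u}} (hθ : θ.IsRegular) {g : θ.ord.ToType → I → ℕ}
    (hg : IsNonstandardScale D g) : lcfAleph0 D = θ := by
  have hle : ∀ S : Set (I → ℕ), (∀ f ∈ S, IsNonstandard D f) →
      (∀ h, IsNonstandard D h → ∃ f ∈ S, leD D f h) → θ ≤ #S := by
    intro S hS hcoinit
    by_contra! hlt
    have : Nonempty θ.ord.ToType := Ordinal.nonempty_toType_iff.2 hθ.ord_pos.ne'
    choose! ρ hρ using fun f hf => hg.2 f (hS f hf)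
    obtain ⟨α, hα⟩ := hθ.exists_forall_lt (ρ '' S) (mk_image_le.trans_lt hlt)
    obtain ⟨f, hf, hle⟩ := hcoinit (g α) (hg.1 α)
    have hlt := hρ f hf α (hα _ (mem_image_of_mem _ hf)).le
    obtain ⟨t, ht, ht'⟩ := Filter.nonempty_of_mem (Filter.inter_mem hle hlt)
    exact absurd ht' (not_lt.2 ht : ¬ g α t < f t)
  have hrange : (∀ f ∈ range g, IsNonstandard D f) ∧
      ∀ h, IsNonstandard D h → ∃ f ∈ range g, leD D f h := by
    refine ⟨by rintro _ ⟨α, rfl⟩; exact hg.1 α, fun h hh => ?_⟩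
    obtain ⟨α, hα⟩ := hg.2 h hh
    have hlt : ∀ᶠ t in D, g α t < h t := hα α le_rfl
    exact ⟨g α, mem_range_self _, hlt.mono fun t ht => ht.le⟩
  have hcard : #(range g) = θ := by
    refine le_antisymm (mk_range_le.trans ?_) (hle _ hrange.1 hrange.2)
    rw [mk_toType, card_ord]
  refine le_antisymm (csInf_le' ⟨range g, hcard, hrange⟩) (le_csInf ⟨θ, range g, hcard, hrange⟩ ?_)
  rintro _ ⟨S, rfl, hS⟩
  exact hle S hS.1 hS.2

theorem exists_ultrafilter_isNonstandardScale {θ : Cardinal.{u}} (hθ : θ.IsRegular)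
    (hθ₀ : ℵ₀ < θ) (hθc : θ ≤ (2 : Cardinal.{u}) ^ (ℵ₀ : Cardinal.{u})) :
    ∃ (U : Ultrafilter (ULift.{u} ℕ)) (g : θ.ord.ToType → ULift.{u} ℕ → ℕ),
      IsNonstandardScale (U : Filter (ULift.{u} ℕ)) g := by
  classical
  let N := ULift.{u} ℕ
  have hN : #N = ℵ₀ := by simp [N]
  let Φ : PUnit.{u + 1} → Set (Set N) → Set (N → N → Prop) := fun _ V =>
    {φ | (∃ n : ℕ, φ = fun _ m => n < m.down) ∨
      ∃ f : N → ℕ, (∀ n, {t | n < f t} ∈ V) ∧ φ = fun t m => m.down < f t}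
  obtain ⟨U, B, g, hmono, huniv, hempty, hinter, hcof, hreal⟩ :=
    exists_ultrafilter_realizing (I := N) (C := N) (P := PUnit.{u + 1}) (W := θ.ord.ToType) le_rfl
      (by rw [hN, mk_punit]; exact one_le_two.trans (self_le_power _ one_lt_aleph0.le))
      (by rwa [mk_toType, card_ord, hN])
      (fun S hS => hθ.exists_forall_lt S (hS.trans_lt (by rwa [hN]))) Φ
  have hfs : ∀ α, FinitelySatisfiable (Φ ⟨⟩ ((U : Filter N).sets ∩ B α))
      ((U : Filter N).sets ∩ B α) (B α) := by
    intro α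
    refine .of_eventually (hinter α) ?_ fun T hT => ?_
    · rintro _ (⟨n, rfl⟩ | ⟨f, hf, rfl⟩) c
      · by_cases hn : n < c.down
        · simpa [hn] using huniv α
        · simpa [hn] using hempty α
      · exact (hf c.down).2
    · let ν : (N → N → Prop) → ℕ := fun φ =>
        if h : ∃ n : ℕ, φ = fun _ m => n < m.down then h.choose else 0
      refine ⟨⟨T.sup ν + 1⟩, fun φ hφ => ?_⟩
      by_cases h : ∃ n : ℕ, φ = fun _ m => n < m.down
      · refine Filter.Eventually.of_forall fun t => ?_
        have h₁ : ν φ = h.choose := dif_pos h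
        have h₂ := Finset.le_sup (f := ν) hφ
        rw [h.choose_spec]
        change h.choose < T.sup ν + 1
        lia
      · rcases hT hφ with h' | ⟨f, hf, rfl⟩
        · exact absurd h' h
        · exact (hf _).1
  refine ⟨U, fun α t => (g α ⟨⟩ t).down, fun α n => hreal α ⟨⟩ (hfs α) _ (Or.inl ⟨n, rfl⟩), ?_⟩
  intro f hf
  obtain ⟨α, hα⟩ := hcof (range fun n : ULift.{u} ℕ => {t | n.down < f t}) mk_range_le
  exact ⟨α, fun β hβ => hreal β ⟨⟩ (hfs β) _
    (Or.inr ⟨f, fun n => ⟨hf n, hmono hβ (hα ⟨⟨n⟩, rfl⟩)⟩, rfl⟩)⟩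

/-- The sum of the ultrafilter `E` along the ultrafilter `U`, transported by `e`. -/
def Ultrafilter.sumAlong {N I K : Type u} (U : Ultrafilter N) (E : Ultrafilter I)
    (e : N × I ≃ K) : Ultrafilter K :=
  U.bind fun k => E.map fun t => e (k, t)

section SumAlong

variable {N I K : Type u} {U : Ultrafilter N} {E : Ultrafilter I} {e : N × I ≃ K}

theorem Ultrafilter.mem_sumAlong {X : Set K} :
    X ∈ (U.sumAlong E e : Filter K) ↔ ∀ᶠ k in U, ∀ᶠ t in E, e (k, t) ∈ X := Iff.rfl

theorem isNonstandardScale_sumAlong {W : Type u} [Preorder W] [Nonempty W] {g : W → N → ℕ}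
    (hg : IsNonstandardScale (U : Filter N) g) :
    IsNonstandardScale (U.sumAlong E e : Filter K) fun α s => g α (e.symm s).1 := by
  classical
  refine ⟨fun α n => ?_, fun f hf => ?_⟩
  · have h : ∀ᶠ k in U, n < g α k := hg.1 α n
    refine Ultrafilter.mem_sumAlong.2 (h.mono fun k hk => ?_)
    simpa using hk
  · let α₀ : W := Classical.arbitrary W
    let f' : N → ℕ := fun k => Nat.findGreatest (fun m => ∀ᶠ t in E, m ≤ f (e (k, t))) (g α₀ k)
    have hf' : IsNonstandard (U : Filter N) f' := by
      intro n
      have h₁ : ∀ᶠ k in U, ∀ᶠ t in E, n < f (e (k, t)) := hf n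
      have h₂ : ∀ᶠ k in U, n < g α₀ k := hg.1 α₀ n
      exact (h₁.and h₂).mono fun k hk => Nat.le_findGreatest hk.2 hk.1
    obtain ⟨α, hα⟩ := hg.2 f' hf'
    refine ⟨α, fun β hβ => ?_⟩
    have hlt : ∀ᶠ k in U, g β k < f' k := hα β hβ
    refine Ultrafilter.mem_sumAlong.2 (hlt.mono fun k hk => ?_)
    have h : ∀ᶠ t in E, f' k ≤ f (e (k, t)) :=
      Nat.findGreatest_spec (P := fun m => ∀ᶠ t in E, m ≤ f (e (k, t))) (Nat.zero_le _)
        (Filter.Eventually.of_forall fun t => Nat.zero_le _)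
    refine h.mono fun t ht => ?_
    simpa using hk.trans_le ht

theorem isRegularFilter_sumAlong
    (hE : ∃ X : I → Set I, (∀ i, X i ∈ E) ∧ ∀ t, {i | t ∈ X i}.Finite) :
    IsRegularFilter #I (U.sumAlong E e : Filter K) := by
  obtain ⟨X, hX, hfin⟩ := hE
  obtain ⟨σ⟩ : Nonempty ((#I).ord.ToType ≃ I) := by
    rw [← Cardinal.eq, mk_toType, card_ord]
  refine ⟨fun o => {s | ∀ h : o < (#I).ord, (e.symm s).2 ∈ X (σ (Ordinal.ToType.mk ⟨o, h⟩))},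
    fun o ho => Ultrafilter.mem_sumAlong.2 (Filter.Eventually.of_forall fun k => ?_), fun s => ?_⟩
  · refine Filter.mem_of_superset (hX (σ (Ordinal.ToType.mk ⟨o, ho⟩))) fun t ht _ => ?_
    simpa using ht
  · have hinj : Function.Injective fun x : Iio (#I).ord => σ (Ordinal.ToType.mk x) :=
      σ.injective.comp Ordinal.ToType.mk.injective
    refine (((hfin (e.symm s).2).preimage hinj.injOn).image Subtype.val).subset ?_
    rintro o ⟨ho, h⟩
    exact ⟨⟨o, ho⟩, h ho, rfl⟩

/-- Filling of pre-cuts along a cofinal subset of the upper sequence. -/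
theorem exists_le_lt_sumAlong {W₁ W₂ : Type u} [LinearOrder W₂] [Nonempty W₁]
    (hE : ∀ a b : I → I → ℕ, (∀ i j, ltD (E : Filter I) (a i) (b j)) →
      ∃ c : I → ℕ, (∀ i, leD (E : Filter I) (a i) c) ∧ ∀ j, ltD (E : Filter I) c (b j))
    (h₁ : #W₁ ≤ #I) (h₂ : #W₂ ≤ #I) (hcof : #(W₁ → Set N) < Order.cof W₂) {a : W₁ → K → ℕ}
    {b : W₂ → K → ℕ} (hab : ∀ x y, ltD (U.sumAlong E e : Filter K) (a x) (b y)) :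
    ∃ c : K → ℕ, (∀ x, leD (U.sumAlong E e : Filter K) (a x) c) ∧
      ∃ Z : Set W₂, IsCofinal Z ∧ ∀ y ∈ Z, ltD (U.sumAlong E e : Filter K) c (b y) := by
  classical
  let A : W₂ → W₁ → Set N := fun y x => {k | ∀ᶠ t in E, a x (e (k, t)) < b y (e (k, t))}
  obtain ⟨F, hF⟩ : ∃ F, IsCofinal (A ⁻¹' {F}) := by
    refine isCofinal_of_isCofinal_iUnion (s := fun F => A ⁻¹' {F}) ?_ hcof
    have : ⋃ F, A ⁻¹' {F} = Set.univ := by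
      ext y
      simp
    rw [this]
    exact IsCofinal.univ
  have hW₂ : Nonempty W₂ := Order.cof_ne_zero_iff.1 (ne_bot_of_gt hcof)
  have hZ : Nonempty (A ⁻¹' {F}) := by
    obtain ⟨y, hy, -⟩ := hF (Classical.arbitrary W₂)
    exact ⟨⟨y, hy⟩⟩
  have hsurj : ∀ (V : Type u) [Nonempty V], #V ≤ #I → ∃ σ : I → V, Function.Surjective σ := by
    rintro V _ ⟨f⟩
    exact ⟨Function.invFun f, Function.invFun_surjective f.injective⟩
  obtain ⟨σ, hσ⟩ := hsurj W₁ h₁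
  obtain ⟨τ, hτ⟩ := hsurj (A ⁻¹' {F}) ((mk_set_le _).trans h₂)
  have hFU : ∀ x, F x ∈ U := by
    intro x
    obtain ⟨⟨y, hy⟩⟩ := hZ
    have : A y x ∈ U := hab x y
    rwa [show A y = F from hy] at this
  have hlt : ∀ k x, k ∈ F x → ∀ j, ∀ᶠ t in E, a x (e (k, t)) < b (τ j) (e (k, t)) := by
    intro k x hk j
    have : k ∈ A (τ j) x := by rwa [show A (τ j) = F from (τ j).2]
    exact this
  let x₀ : W₁ := Classical.arbitrary W₁
  have hc : ∀ k, ∃ c : I → ℕ, k ∈ F x₀ →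
      (∀ x, k ∈ F x → ∀ᶠ t in E, a x (e (k, t)) ≤ c t) ∧
      ∀ j, ∀ᶠ t in E, c t < b (τ j) (e (k, t)) := by
    intro k
    by_cases hk : k ∈ F x₀
    · obtain ⟨c, hc, hc'⟩ := hE
        (fun i t => if k ∈ F (σ i) then a (σ i) (e (k, t)) else a x₀ (e (k, t)))
        (fun j t => b (τ j) (e (k, t))) (fun i j => by
          by_cases hi : k ∈ F (σ i)
          · simp only [if_pos hi]
            exact hlt k _ hi j
          · simp only [if_neg hi]
            exact hlt k _ hk j)
      refine ⟨c, fun _ => ⟨fun x hx => ?_, hc'⟩⟩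
      obtain ⟨i, rfl⟩ := hσ x
      have := hc i
      simp only [if_pos hx] at this
      exact this
    · exact ⟨0, fun h => absurd h hk⟩
  choose c hc using hc
  refine ⟨fun s => c (e.symm s).1 (e.symm s).2, fun x => ?_, _, hF, fun y hy => ?_⟩
  · refine Ultrafilter.mem_sumAlong.2 (Filter.mem_of_superset
      (Filter.inter_mem (hFU x₀) (hFU x)) fun k hk => ((hc k hk.1).1 x hk.2).mono fun t ht => ?_)
    simpa using ht
  · obtain ⟨j, hj⟩ := hτ ⟨y, hy⟩
    refine Ultrafilter.mem_sumAlong.2 (Filter.mem_of_superset (hFU x₀) fun k hk =>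
      ((hc k hk).2 j).mono fun t ht => ?_)
    rw [hj] at ht
    simpa using ht

end SumAlong

end Applications

/-- (ZFC version via the polarized partition relation) for regular
`kappa₁, kappa₂ ≤ lam` with `2^ℵ₀ < 2^kappa₁ < kappa₂` and regular `ℵ₀ < theta ≤ 2^ℵ₀`,
there is a `lam`-regular ultrafilter `D` on a set of cardinality `lam` with
`lcf(ℵ₀, D) = theta` in which every `(kappa₁, kappa₂)`-pre-cut is realized. -/
theorem asymmetric_cuts_small_lcf {I : Type u} (kappa₁ kappa₂ theta lam : Cardinal.{u})
    (hk1 : kappa₁.IsRegular) (hk2 : kappa₂.IsRegular)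
    (hk1l : kappa₁ ≤ lam) (hk2l : kappa₂ ≤ lam)
    (hexp1 : (2 : Cardinal.{u}) ^ (ℵ₀ : Cardinal.{u}) < 2 ^ kappa₁) (hexp2 : (2 : Cardinal.{u}) ^ kappa₁ < kappa₂)
    (ht0 : ℵ₀ < theta) (htreg : theta.IsRegular) (htc : theta ≤ (2 : Cardinal.{u}) ^ (ℵ₀ : Cardinal.{u}))
    (hI : #I = lam) :
    ∃ D : Ultrafilter I,
      IsRegularFilter lam (D : Filter I) ∧
      lcfAleph0 (D : Filter I) = theta ∧
      ∀ a₁ a₂ : Ordinal.{u} → I → ℕ,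
        (∀ ε ε' : Ordinal.{u}, ε < ε' → ε' < kappa₁.ord →
          ltD (D : Filter I) (a₁ ε) (a₁ ε')) →
        (∀ ζ ζ' : Ordinal.{u}, ζ < ζ' → ζ' < kappa₂.ord →
          ltD (D : Filter I) (a₂ ζ') (a₂ ζ)) →
        (∀ ε ζ : Ordinal.{u}, ε < kappa₁.ord → ζ < kappa₂.ord →
          ltD (D : Filter I) (a₁ ε) (a₂ ζ)) →
        ∃ b : I → ℕ,
          (∀ ε, ε < kappa₁.ord → ltD (D : Filter I) (a₁ ε) b) ∧
          ∀ ζ, ζ < kappa₂.ord → ltD (D : Filter I) b (a₂ ζ) := by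
  have : Infinite I := infinite_iff.2 (hI ▸ hk1.aleph0_le.trans hk1l)
  have hIinf := aleph0_le_mk I
  obtain ⟨E, hEreg, hE⟩ := exists_ultrafilter_filling_cuts I
  obtain ⟨U, g, hg⟩ := exists_ultrafilter_isNonstandardScale htreg ht0 htc
  obtain ⟨e⟩ : Nonempty (ULift.{u} ℕ × I ≃ I) := by
    rw [← Cardinal.eq]
    simp [hIinf]
  have : Nonempty theta.ord.ToType := Ordinal.nonempty_toType_iff.2 htreg.ord_pos.ne'
  have : Nonempty kappa₁.ord.ToType := Ordinal.nonempty_toType_iff.2 hk1.ord_pos.ne'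
  refine ⟨U.sumAlong E e, hI ▸ isRegularFilter_sumAlong hEreg,
    (isNonstandardScale_sumAlong hg).lcfAleph0_eq htreg, fun a₁ a₂ ha₁ ha₂ ha => ?_⟩
  obtain ⟨c, hc₁, Z, hZ, hc₂⟩ := exists_le_lt_sumAlong (U := U) (e := e)
    (W₁ := kappa₁.ord.ToType) (W₂ := kappa₂.ord.ToType)
    (a := fun x => a₁ x.toOrd) (b := fun y => a₂ y.toOrd) hE
    (by rwa [mk_toType, card_ord, hI]) (by rwa [mk_toType, card_ord, hI])
    (by
      rw [Ordinal.cof_toType, hk2.cof_ord, mk_arrow, mk_toType, card_ord, mk_set]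
      rwa [mk_uLift, mk_nat, lift_aleph0, lift_id, lift_id, ← power_mul, aleph0_mul_eq hk1.aleph0_le])
    (fun x y => ha _ _ x.toOrd.2 y.toOrd.2)
  refine ⟨c, fun ε hε => ?_, fun ζ hζ => ?_⟩
  · have hε' : Order.succ ε < kappa₁.ord := (isSuccLimit_ord hk1.aleph0_le).succ_lt hε
    have h₁ : ∀ᶠ t in _, _ ≤ _ := hc₁ (Ordinal.ToType.mk ⟨Order.succ ε, hε'⟩)
    have h₂ : ∀ᶠ t in _, _ < _ := ha₁ ε _ (Order.lt_succ ε) hε'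
    simp only [Ordinal.ToType.toOrd, OrderIso.symm_apply_apply] at h₁
    exact (h₁.and h₂).mono fun t ht => ht.2.trans_le ht.1
  · obtain ⟨y, hy, hle⟩ := hZ (Ordinal.ToType.mk ⟨ζ, hζ⟩)
    have hle' : ζ ≤ y.toOrd := by
      have := Ordinal.ToType.mk.symm.monotone hle
      rwa [OrderIso.symm_apply_apply] at this
    rcases hle'.eq_or_lt with h | h
    · rw [h]
      exact hc₂ y hy
    · have h₁ : ∀ᶠ t in _, _ < _ := hc₂ y hy
      have h₂ : ∀ᶠ t in _, _ < _ := ha₂ ζ _ h y.toOrd.2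
      exact (h₁.and h₂).mono fun t ht => ht.1.trans ht.2
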